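/- arXiv:0907.3912 — 2 statements merged into one kernel-verified Lean document; each statement's English description precedes it below -/
import Mathlib

section
/- Let k be an infinite field of characteristic 2 and let A = k[x, y, z]/(x^2, y^2, z^2). Then A is a standard graded artinian Gorenstein algebra with Hilbert function (1, 3, 3, 1), and A does not have the weak Lefschetz property: for every linear form L ∈ R_1, the multiplication map ·L : A_1 → A_2 fails to have maximal rank. -/
open MvPolynomial

/-- The degree-`d` graded component of `R/I` (the image of the space of
degree-`d` homogeneous polynomials in the quotient), as a `k`-submodule. -/
noncomputable def gradedPiece (k : Type*) [Field k] (r : ℕ)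
    (I : Ideal (MvPolynomial (Fin r) k)) (d : ℕ) :
    Submodule k (MvPolynomial (Fin r) k ⧸ I) :=
  Submodule.map (Ideal.Quotient.mkₐ k I).toLinearMap
    (homogeneousSubmodule (Fin r) k d)

/-- The Hilbert function of `R/I` in degree `d`. -/
noncomputable def hilb (k : Type*) [Field k] (r : ℕ)
    (I : Ideal (MvPolynomial (Fin r) k)) (d : ℕ) : ℕ :=
  Module.finrank k (gradedPiece k r I d)

/-- `I` is a homogeneous ideal. -/
def IsHomogIdeal {k : Type*} [Field k] {r : ℕ}
    (I : Ideal (MvPolynomial (Fin r) k)) : Prop :=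
  ∀ f ∈ I, ∀ n : ℕ, homogeneousComponent n f ∈ I

/-- `I` contains no nonzero linear forms. -/
def NoLinearForms {k : Type*} [Field k] {r : ℕ}
    (I : Ideal (MvPolynomial (Fin r) k)) : Prop :=
  ∀ f ∈ I, f.IsHomogeneous 1 → f = 0

/-- The dimension of the degree-`i` component of the socle of `R/I`. -/
noncomputable def socDim (k : Type*) [Field k] (r : ℕ)
    (I : Ideal (MvPolynomial (Fin r) k)) (i : ℕ) : ℕ :=
  Module.finrank k (Submodule.map (Ideal.Quotient.mkₐ k I).toLinearMap
    (homogeneousSubmodule (Fin r) k i ⊓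
      ⨅ j : Fin r, Submodule.comap (LinearMap.mulLeft k (X j))
        (Submodule.restrictScalars k I)))

/-- `R/I` is a standard graded artinian algebra:
`I` is homogeneous and `R/I` is finite-dimensional over `k`. -/
def StdArtinian (k : Type*) [Field k] (r : ℕ)
    (I : Ideal (MvPolynomial (Fin r) k)) : Prop :=
  IsHomogIdeal I ∧ Module.Finite k (MvPolynomial (Fin r) k ⧸ I)

/-- `R/I` has socle degree `e`: `e` is the largest degree with nonzero
Hilbert function. -/
def SocleDegree (k : Type*) [Field k] (r : ℕ)
    (I : Ideal (MvPolynomial (Fin r) k)) (e : ℕ) : Prop :=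
  hilb k r I e ≠ 0 ∧ ∀ j : ℕ, e < j → hilb k r I j = 0

/-- `R/I` is a standard graded artinian Gorenstein algebra of socle degree `e`:
the socle vanishes below degree `e` and is one-dimensional in degree `e`. -/
def Gorenstein (k : Type*) [Field k] (r e : ℕ)
    (I : Ideal (MvPolynomial (Fin r) k)) : Prop :=
  StdArtinian k r I ∧ SocleDegree k r I e ∧
    (∀ i : ℕ, i < e → socDim k r I i = 0) ∧ socDim k r I e = 1

/-- `R/I` is a standard graded artinian level algebra of socle degree `e`. -/
def LevelAlg (k : Type*) [Field k] (r e : ℕ)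
    (I : Ideal (MvPolynomial (Fin r) k)) : Prop :=
  StdArtinian k r I ∧ SocleDegree k r I e ∧
    (∀ i : ℕ, i < e → socDim k r I i = 0)

/-- The linear form with coefficient vector `c`. -/
noncomputable def linForm {k : Type*} [Field k] {r : ℕ} (c : Fin r → k) :
    MvPolynomial (Fin r) k :=
  ∑ i, C (c i) * X i

/-- A property `P` holds for a general linear form: there is a nonempty
(basic) Zariski-open subset of the space of linear forms on which `P` holds. -/
def Generically (k : Type*) [Field k] (r : ℕ)
    (P : MvPolynomial (Fin r) k → Prop) : Prop :=
  ∃ Q : MvPolynomial (Fin r) k, Q ≠ 0 ∧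
    ∀ c : Fin r → k, eval c Q ≠ 0 → P (linForm c)

/-- `R/I` has the weak Lefschetz property (socle degree `e`): multiplication
by some linear form has maximal rank from each degree `i < e` to degree `i+1`. -/
def WLP (k : Type*) [Field k] (r e : ℕ)
    (I : Ideal (MvPolynomial (Fin r) k)) : Prop :=
  ∃ L : MvPolynomial (Fin r) k, L.IsHomogeneous 1 ∧
    ∀ i : ℕ, i < e →
      Module.finrank k (Submodule.map
        (LinearMap.mulLeft k (Ideal.Quotient.mk I L)) (gradedPiece k r I i)) =
      min (hilb k r I i) (hilb k r I (i + 1))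

/-- The largest `t` with `choose t i ≤ n`: the leading top in the
`i`-binomial expansion of `n`. -/
noncomputable def binTop (n i : ℕ) : ℕ := sSup {t : ℕ | Nat.choose t i ≤ n}

/-- Auxiliary recursion computing `((n)_{(i)})⁻¹₀`, i.e. the sum
`C(n_i - 1, i) + C(n_{i-1} - 1, i-1) + ⋯ + C(n_j - 1, j)` where
`n_{(i)} = C(n_i, i) + ⋯ + C(n_j, j)` is the `i`-binomial expansion of `n`. -/
noncomputable def greenBoundAux : ℕ → ℕ → ℕ
  | 0, _ => 0
  | (i + 1), n =>
    if n = 0 then 0 else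
      Nat.choose (binTop n (i + 1) - 1) (i + 1) +
        greenBoundAux i (n - Nat.choose (binTop n (i + 1)) (i + 1))

/-- `greenBound n i = ((n)_{(i)})⁻¹₀`. -/
noncomputable def greenBound (n i : ℕ) : ℕ := greenBoundAux i n

/-- The ideal generated by the squares of the variables. -/
noncomputable def squaresIdeal (k : Type*) [Field k] (n : ℕ) :
    Ideal (MvPolynomial (Fin n) k) :=
  Ideal.span (Set.range fun i => X i ^ 2)

/-- The exponent vector of the squarefree monomial supported on `s`. -/
noncomputable def squarefreeExponent {n : ℕ} (s : Finset (Fin n)) : Fin n →₀ ℕ :=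
  Finsupp.indicator s fun _ _ => 1

/-- The linear map recording the coefficients of the squarefree monomials. -/
noncomputable def squarefreeCoeff (k : Type*) [Field k] (n : ℕ) :
    MvPolynomial (Fin n) k →ₗ[k] (Finset (Fin n) → k) :=
  LinearMap.pi fun s => lcoeff k (squarefreeExponent s)

section SquaresIdeal

variable {k : Type*} [Field k] {n : ℕ}

lemma squarefreeExponent_apply (s : Finset (Fin n)) (i : Fin n) :
    squarefreeExponent s i = if i ∈ s then 1 else 0 := by
  simp [squarefreeExponent, Finsupp.indicator_apply]

lemma degree_squarefreeExponent (s : Finset (Fin n)) :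
    (squarefreeExponent s).degree = s.card := by
  simp [Finsupp.degree_eq_sum, squarefreeExponent_apply]

lemma squarefreeExponent_injective :
    Function.Injective (squarefreeExponent : Finset (Fin n) → Fin n →₀ ℕ) := by
  intro s t h
  ext i
  have := DFunLike.congr_fun h i
  simp only [squarefreeExponent_apply] at this
  split_ifs at this <;> simp_all

lemma squarefreeExponent_support {m : Fin n →₀ ℕ} (hm : ∀ i, m i < 2) :
    squarefreeExponent m.support = m := by
  ext i
  have := hm i
  simp only [squarefreeExponent_apply, Finsupp.mem_support_iff]
  split_ifs <;> omega

lemma squarefreeExponent_insert {s : Finset (Fin n)} {j : Fin n} (hj : j ∉ s) :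
    squarefreeExponent (insert j s) = squarefreeExponent s + Finsupp.single j 1 := by
  ext i
  by_cases h : i = j
  · subst h
    simp [squarefreeExponent_apply, hj]
  · simp [squarefreeExponent_apply, h]

@[simp]
lemma squarefreeCoeff_apply (f : MvPolynomial (Fin n) k) (s : Finset (Fin n)) :
    squarefreeCoeff k n f s = coeff (squarefreeExponent s) f := rfl

lemma mem_squaresIdeal_iff {f : MvPolynomial (Fin n) k} :
    f ∈ squaresIdeal k n ↔ ∀ s, coeff (squarefreeExponent s) f = 0 := by
  have hspan : squaresIdeal k n = Ideal.span
      ((fun m => monomial m (1 : k)) '' Set.range fun i : Fin n => Finsupp.single i 2) := by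
    rw [squaresIdeal, ← Set.range_comp]
    simp [Function.comp_def, X_pow_eq_monomial]
  rw [hspan, mem_ideal_span_monomial_image]
  constructor
  · intro h s
    by_contra hs
    obtain ⟨_, ⟨i, rfl⟩, hi⟩ := h _ (mem_support_iff.2 hs)
    have := hi i
    simp only [Finsupp.single_eq_same, squarefreeExponent_apply] at this
    split_ifs at this <;> omega
  · intro h m hm
    by_contra! hlt
    refine mem_support_iff.1 hm ?_
    rw [← squarefreeExponent_support (m := m), h]
    intro i
    by_contra! hi
    exact hlt _ ⟨i, rfl⟩ (by simpa using hi)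

lemma ker_squarefreeCoeff :
    LinearMap.ker (squarefreeCoeff k n) = (squaresIdeal k n).restrictScalars k := by
  ext f
  simp [mem_squaresIdeal_iff, funext_iff]

/-- The coordinates of a residue class in the basis of squarefree monomials. -/
noncomputable def quotientCoords (k : Type*) [Field k] (n : ℕ) :
    (MvPolynomial (Fin n) k ⧸ squaresIdeal k n) →ₗ[k] (Finset (Fin n) → k) :=
  ((squaresIdeal k n).restrictScalars k).liftQ (squarefreeCoeff k n) ker_squarefreeCoeff.ge

lemma quotientCoords_comp_mk :
    quotientCoords k n ∘ₗ (Ideal.Quotient.mkₐ k (squaresIdeal k n)).toLinearMap =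
      squarefreeCoeff k n := rfl

lemma quotientCoords_injective : Function.Injective (quotientCoords k n) :=
  LinearMap.ker_eq_bot.1 <| Submodule.ker_liftQ_eq_bot _ _ _ ker_squarefreeCoeff.le

lemma finrank_map_mk_eq (V : Submodule k (MvPolynomial (Fin n) k)) :
    Module.finrank k (V.map (Ideal.Quotient.mkₐ k (squaresIdeal k n)).toLinearMap) =
      Module.finrank k (V.map (squarefreeCoeff k n)) := by
  rw [← quotientCoords_comp_mk, Submodule.map_comp]
  exact LinearEquiv.finrank_eq (Submodule.equivMapOfInjective _ quotientCoords_injective _)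

instance finite_quotient_squaresIdeal :
    Module.Finite k (MvPolynomial (Fin n) k ⧸ squaresIdeal k n) :=
  Module.Finite.of_injective _ quotientCoords_injective

lemma map_squarefreeCoeff_homogeneousSubmodule (d : ℕ) :
    (homogeneousSubmodule (Fin n) k d).map (squarefreeCoeff k n) =
      ⨅ s ∈ {s : Finset (Fin n) | s.card ≠ d},
        LinearMap.ker (LinearMap.proj s : (Finset (Fin n) → k) →ₗ[k] k) := by
  ext v
  simp only [Submodule.mem_iInf, LinearMap.mem_ker, LinearMap.proj_apply, Submodule.mem_map,
    Set.mem_ofPred_eq, mem_homogeneousSubmodule]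
  constructor
  · rintro ⟨f, hf, rfl⟩ s hs
    exact hf.coeff_eq_zero (by rwa [degree_squarefreeExponent])
  · intro hv
    refine ⟨∑ s, monomial (squarefreeExponent s) (v s), ?_, ?_⟩
    · refine IsHomogeneous.sum _ _ _ fun s _ => ?_
      by_cases hs : s.card = d
      · exact isHomogeneous_monomial _ (by rw [degree_squarefreeExponent, hs])
      · rw [hv s hs, map_zero]
        exact isHomogeneous_zero _ _ _
    · ext t
      simp [coeff_sum, coeff_monomial, squarefreeExponent_injective.eq_iff]

lemma hilb_squaresIdeal (d : ℕ) : hilb k n (squaresIdeal k n) d = n.choose d := by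
  classical
  rw [hilb, gradedPiece, finrank_map_mk_eq, map_squarefreeCoeff_homogeneousSubmodule,
    LinearEquiv.finrank_eq (LinearMap.iInfKerProjEquiv k (fun _ : Finset (Fin n) => k)
      (I := {s | s.card = d}) (J := {s | s.card ≠ d}) ?_ ?_), Module.finrank_fintype_fun_eq_card]
  · simp
  · exact Set.disjoint_left.2 fun s hs ht => ht hs
  · exact fun s _ => em _

lemma isHomogIdeal_squaresIdeal : IsHomogIdeal (squaresIdeal k n) := by
  intro f hf d
  rw [mem_squaresIdeal_iff] at hf ⊢
  intro s
  rw [coeff_homogeneousComponent, hf, ite_self]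

lemma noLinearForms_squaresIdeal : NoLinearForms (squaresIdeal k n) := by
  intro f hf h1
  ext m
  by_cases hm : m.degree = 1
  · rw [← squarefreeExponent_support (m := m) fun i => ?_, mem_squaresIdeal_iff.1 hf, coeff_zero]
    have := Finsupp.le_degree i m
    omega
  · exact h1.coeff_eq_zero hm

lemma mem_squaresIdeal_of_isHomogeneous {d : ℕ} (hd : n < d) {f : MvPolynomial (Fin n) k}
    (hf : f.IsHomogeneous d) : f ∈ squaresIdeal k n := by
  refine mem_squaresIdeal_iff.2 fun s => hf.coeff_eq_zero ?_
  rw [degree_squarefreeExponent]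
  have := s.card_le_univ
  rw [Fintype.card_fin] at this
  omega

lemma mem_squaresIdeal_of_X_mul_mem {d : ℕ} (hd : d < n) {f : MvPolynomial (Fin n) k}
    (hf : f.IsHomogeneous d) (hX : ∀ j, X j * f ∈ squaresIdeal k n) : f ∈ squaresIdeal k n := by
  refine mem_squaresIdeal_iff.2 fun s => ?_
  by_cases hs : s.card = d
  · obtain ⟨j, hj⟩ : ∃ j, j ∉ s := by
      by_contra! h
      rw [Finset.eq_univ_iff_forall.2 h, Finset.card_univ, Fintype.card_fin] at hs
      omega
    have := mem_squaresIdeal_iff.1 (hX j) (insert j s)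
    rwa [squarefreeExponent_insert hj, add_comm, coeff_X_mul] at this
  · exact hf.coeff_eq_zero (by rwa [degree_squarefreeExponent])

lemma socDim_squaresIdeal_of_lt {d : ℕ} (hd : d < n) :
    socDim k n (squaresIdeal k n) d = 0 := by
  rw [socDim, finrank_map_mk_eq, Submodule.finrank_eq_zero, ← LinearMap.le_ker_iff_map,
    ker_squarefreeCoeff]
  rintro f ⟨hf, hX⟩
  refine mem_squaresIdeal_of_X_mul_mem hd hf fun j => ?_
  simpa using Submodule.mem_iInf _ |>.1 hX j

lemma socDim_squaresIdeal_self : socDim k n (squaresIdeal k n) n = 1 := by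
  rw [socDim, inf_eq_left.2, ← gradedPiece, ← hilb, hilb_squaresIdeal, Nat.choose_self]
  refine le_iInf fun j f hf => mem_squaresIdeal_of_isHomogeneous (d := 1 + n) (by omega) ?_
  exact (isHomogeneous_X k j).mul hf

lemma gorenstein_squaresIdeal : Gorenstein k n n (squaresIdeal k n) := by
  refine ⟨⟨isHomogIdeal_squaresIdeal, inferInstance⟩, ⟨?_, fun j hj => ?_⟩,
    fun _ => socDim_squaresIdeal_of_lt, socDim_squaresIdeal_self⟩
  · simp [hilb_squaresIdeal]
  · rw [hilb_squaresIdeal, Nat.choose_eq_zero_of_lt hj]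

lemma sq_mem_squaresIdeal [CharP k 2] {f : MvPolynomial (Fin n) k}
    (hf : f.IsHomogeneous 1) : f ^ 2 ∈ squaresIdeal k n := by
  have hle : Ideal.span (X '' Set.univ) ≤
      (squaresIdeal k n).comap (frobenius (MvPolynomial (Fin n) k) 2) := by
    rw [Ideal.span_le]
    rintro _ ⟨i, -, rfl⟩
    exact Ideal.subset_span ⟨i, rfl⟩
  refine hle (mem_ideal_span_X_image.2 fun m hm => ?_)
  by_contra! h
  have h0 : m = 0 := by
    ext i
    exact h i trivial
  exact mem_support_iff.1 hm (hf.coeff_eq_zero (by simp [h0]))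

lemma finrank_map_mulLeft_ne_hilb_one [CharP k 2] (hn : n ≠ 0) {L : MvPolynomial (Fin n) k}
    (hL : L.IsHomogeneous 1) :
    Module.finrank k (Submodule.map
      (LinearMap.mulLeft k (Ideal.Quotient.mk (squaresIdeal k n) L))
        (gradedPiece k n (squaresIdeal k n) 1)) ≠ hilb k n (squaresIdeal k n) 1 := by
  set φ := LinearMap.mulLeft k (Ideal.Quotient.mk (squaresIdeal k n) L)
  set V := gradedPiece k n (squaresIdeal k n) 1
  intro h
  by_cases hL0 : L = 0
  · have hφ : φ = 0 := by
      rw [← LinearMap.mulLeft_zero_eq_zero, ← map_zero (Ideal.Quotient.mk _), ← hL0]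
    rw [hφ, Submodule.map_zero, finrank_bot, hilb_squaresIdeal, Nat.choose_one_right] at h
    exact hn h.symm
  · have hLV : Ideal.Quotient.mk (squaresIdeal k n) L ∈ V := ⟨L, hL, rfl⟩
    have hrank := LinearMap.finrank_range_add_finrank_ker (φ.domRestrict V)
    rw [LinearMap.range_domRestrict, h, show hilb k n (squaresIdeal k n) 1 = Module.finrank k V from rfl,
      add_eq_left] at hrank
    have hker : LinearMap.ker (φ.domRestrict V) = ⊥ := Submodule.finrank_eq_zero.1 hrank
    have hmem : (⟨_, hLV⟩ : V) ∈ LinearMap.ker (φ.domRestrict V) := by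
      simp only [LinearMap.mem_ker, LinearMap.domRestrict_apply, φ, LinearMap.mulLeft_apply]
      rw [← map_mul, ← sq, Ideal.Quotient.eq_zero_iff_mem]
      exact sq_mem_squaresIdeal hL
    rw [hker, Submodule.mem_bot, Submodule.mk_eq_zero, Ideal.Quotient.eq_zero_iff_mem] at hmem
    exact hL0 (noLinearForms_squaresIdeal L hmem hL)

end SquaresIdeal

/-- Remark 3.4: in characteristic two, `A = k[x,y,z]/(x², y², z²)` is a
standard graded artinian Gorenstein algebra with Hilbert function
`(1, 3, 3, 1)` which does not have the weak Lefschetz property: for every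
linear form `L`, multiplication `·L : A_1 → A_2` fails to have maximal rank. -/
theorem char_two_no_wlp
    (k : Type*) [Field k] [Infinite k] [CharP k 2]
    (I : Ideal (MvPolynomial (Fin 3) k))
    (hI : I = Ideal.span {X 0 ^ 2, X 1 ^ 2, X 2 ^ 2}) :
    NoLinearForms I ∧ Gorenstein k 3 3 I ∧
    hilb k 3 I 0 = 1 ∧ hilb k 3 I 1 = 3 ∧ hilb k 3 I 2 = 3 ∧
    hilb k 3 I 3 = 1 ∧
    (∀ L : MvPolynomial (Fin 3) k, L.IsHomogeneous 1 →
      Module.finrank k (Submodule.map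
        (LinearMap.mulLeft k (Ideal.Quotient.mk I L)) (gradedPiece k 3 I 1)) ≠
      min (hilb k 3 I 1) (hilb k 3 I 2)) ∧
    ¬ WLP k 3 3 I := by
  have hIs : I = squaresIdeal k 3 := by
    rw [hI, squaresIdeal]
    congr 1
    ext f
    simp [Fin.exists_fin_succ, eq_comm]
  subst hIs
  have hmin : min (hilb k 3 (squaresIdeal k 3) 1) (hilb k 3 (squaresIdeal k 3) 2) =
      hilb k 3 (squaresIdeal k 3) 1 := by
    simp [hilb_squaresIdeal, Nat.choose]
  refine ⟨noLinearForms_squaresIdeal, gorenstein_squaresIdeal, ?_, ?_, ?_, ?_, ?_, ?_⟩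
  iterate 4 simp [hilb_squaresIdeal, Nat.choose]
  · intro L hL
    rw [hmin]
    exact finrank_map_mulLeft_ne_hilb_one three_ne_zero hL
  · rintro ⟨L, hL, hrank⟩
    have h := hrank 1 (by norm_num)
    rw [hmin] at h
    exact finrank_map_mulLeft_ne_hilb_one three_ne_zero hL h
end

section
/- Failure of Green's Theorem 4 in positive characteristic: Let k be an infinite field of characteristic p > 0, R = k[x, y, z], let d ≥ p, and let G ∈ R_{d−p} be a nonzero form. Let W ⊆ R_d be the degree-d component of the ideal (x^p G, y^p G, z^p G), i.e., W = span_k(x^p G, y^p G, z^p G). Then codim_{R_d} W = C(d+2, 2) − 3 = C(d+1, d) + C(d, d−1) + … + C(3, 2), and for a general linear form ℓ the image W_H of W in (R/(ℓ))_d has codim W_H = d − 1 (equivalently, dim_k W_H = 2). -/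
open MvPolynomial

theorem finrank_homogeneousSubmodule_fin (k : Type*) [Field k] (n d : ℕ) :
    Module.finrank k (homogeneousSubmodule (Fin n) k d) = (n + d - 1).choose d := by
  classical
  have hset : {e : Fin n →₀ ℕ | e.degree = d} =
      ((Finset.univ : Finset (Fin n)).finsuppAntidiag d : Set (Fin n →₀ ℕ)) := by
    ext e
    simp [Finsupp.degree_eq_sum]
  rw [homogeneousSubmodule_eq_finsupp_supported, hset,
    (AddMonoidAlgebra.supportedEquivFinsupp _).finrank_eq, Module.finrank_finsupp_self,
    ← Nat.card_eq_fintype_card, Nat.card_coe_set_eq, Set.ncard_coe_finset,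
    Finset.card_finsuppAntidiag_nat_eq_choose]
  simp

theorem finrank_span_X_pow_mul {k : Type*} [Field k] {n p : ℕ} (hp : p ≠ 0)
    {G : MvPolynomial (Fin n) k} (hG : G ≠ 0) :
    Module.finrank k (Submodule.span k (Set.range fun i : Fin n => X i ^ p * G)) = n := by
  have hmon : LinearIndependent k fun i : Fin n => (X i ^ p : MvPolynomial (Fin n) k) := by
    have hinj : Function.Injective fun i : Fin n => Finsupp.single i p :=
      Finsupp.single_left_injective hp
    have h := (basisMonomials (Fin n) k).linearIndependent.comp _ hinj
    simpa [Function.comp_def, X_pow_eq_monomial] using h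
  have hmul : LinearIndependent k fun i : Fin n => X i ^ p * G :=
    hmon.map' (LinearMap.mulRight k G) (LinearMap.ker_eq_bot.2 (mul_left_injective₀ hG))
  simpa using finrank_span_eq_card hmul

theorem choose_sub_three_eq_sum (d : ℕ) (hd : 1 ≤ d) :
    Nat.choose (d + 2) 2 - 3 =
      ∑ j ∈ Finset.range (d - 1), Nat.choose (d + 1 - j) (d - j) := by
  obtain ⟨m, rfl⟩ := Nat.exists_eq_add_of_le' hd
  have hterm : ∀ j ∈ Finset.range m,
      Nat.choose (m + 1 + 1 - j) (m + 1 - j) = m - 1 - j + 3 := by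
    intro j hj
    have hj := Finset.mem_range.1 hj
    rw [show m + 1 + 1 - j = (m + 1 - j) + 1 by lia, Nat.choose_succ_self_right]
    lia
  rw [Nat.add_sub_cancel, Finset.sum_congr rfl hterm,
    Finset.sum_range_reflect (fun j => j + 3) m]
  have hsum : ∑ j ∈ Finset.range m, (j + 3) + 3 = Nat.choose (m + 1 + 2) 2 := by
    clear hd hterm
    induction m with
    | zero => rfl
    | succ m ih =>
      rw [Finset.sum_range_succ, Nat.choose_succ_succ' (m + 1 + 2) 1, Nat.choose_one_right, ← ih]
      ring
  lia

/-- Restriction of forms in three variables to the plane `z = a x + b y`. -/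
noncomputable def planeRestrict {k : Type*} [Field k] (a b : k) :
    MvPolynomial (Fin 3) k →ₐ[k] MvPolynomial (Fin 2) k :=
  aeval ![X 0, X 1, C a * X 0 + C b * X 1]

section planeRestrict

variable {k : Type*} [Field k] (a b : k)

theorem planeRestrict_rename (f : MvPolynomial (Fin 2) k) :
    planeRestrict a b (rename Fin.castSucc f) = f := by
  rw [planeRestrict, aeval_rename]
  convert aeval_X_left_apply f using 3
  ext i : 1
  fin_cases i <;> rfl

theorem planeRestrict_surjective : Function.Surjective (planeRestrict a b) :=
  fun f => ⟨_, planeRestrict_rename a b f⟩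

theorem eval_planeRestrict (v : Fin 2 → k) (f : MvPolynomial (Fin 3) k) :
    eval v (planeRestrict a b f) = eval ![v 0, v 1, a * v 0 + b * v 1] f := by
  have h : (aeval v).comp (planeRestrict a b) = aeval ![v 0, v 1, a * v 0 + b * v 1] := by
    refine algHom_ext fun i => ?_
    fin_cases i <;> simp [planeRestrict]
  exact DFunLike.congr_fun h f

theorem map_planeRestrict_homogeneousSubmodule (d : ℕ) :
    (homogeneousSubmodule (Fin 3) k d).map (planeRestrict a b).toLinearMap =
      homogeneousSubmodule (Fin 2) k d := by
  apply le_antisymm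
  · rintro _ ⟨f, hf, rfl⟩
    have hX : ∀ i, (![X 0, X 1, C a * X 0 + C b * X 1] i :
        MvPolynomial (Fin 2) k).IsHomogeneous 1 := by
      intro i
      fin_cases i
      · exact isHomogeneous_X _ _
      · exact isHomogeneous_X _ _
      · exact (isHomogeneous_C_mul_X _ _).add (isHomogeneous_C_mul_X _ _)
    simpa [planeRestrict] using ((mem_homogeneousSubmodule d f).1 hf).aeval _ hX
  · intro f hf
    exact ⟨rename Fin.castSucc f, ((mem_homogeneousSubmodule d f).1 hf).rename_isHomogeneous,
      planeRestrict_rename a b f⟩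

theorem ker_planeRestrict {c : Fin 3 → k} (hc : c 2 ≠ 0) :
    RingHom.ker (planeRestrict (-c 0 / c 2) (-c 1 / c 2)) = Ideal.span {linForm c} := by
  set a := -c 0 / c 2 with ha
  set b := -c 1 / c 2 with hb
  have hL : (linForm c : MvPolynomial (Fin 3) k) =
      C (c 2) * (X 2 - (C a * X 0 + C b * X 1)) := by
    have h0 : c 0 = -(c 2 * a) := by rw [ha]; field_simp
    have h1 : c 1 = -(c 2 * b) := by rw [hb]; field_simp
    rw [linForm, Fin.sum_univ_three, h0, h1]
    simp only [map_neg, map_mul]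
    ring
  apply le_antisymm
  · intro f hf
    have hz : Ideal.Quotient.mkₐ k (Ideal.span {linForm c}) (X 2) =
        Ideal.Quotient.mkₐ k (Ideal.span {linForm c}) (C a * X 0 + C b * X 1) := by
      refine Ideal.Quotient.eq.2 (Ideal.mem_span_singleton'.2 ⟨C (c 2)⁻¹, ?_⟩)
      rw [hL, ← mul_assoc, ← C_mul, inv_mul_cancel₀ hc, C_1, one_mul]
    have h : ((Ideal.Quotient.mkₐ k (Ideal.span {linForm c})).comp (rename Fin.castSucc)).comp
        (planeRestrict a b) = Ideal.Quotient.mkₐ k (Ideal.span {linForm c}) := by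
      refine algHom_ext fun i => ?_
      fin_cases i
      · simp [planeRestrict]
      · simp [planeRestrict]
      · refine Eq.trans ?_ hz.symm
        simp [planeRestrict]
    have h' := DFunLike.congr_fun h f
    rw [AlgHom.comp_apply, (RingHom.mem_ker).1 hf, map_zero] at h'
    exact Ideal.Quotient.eq_zero_iff_mem.1 h'.symm
  · rw [Ideal.span_le, Set.singleton_subset_iff, hL]
    simp [planeRestrict, RingHom.mem_ker]

theorem finrank_map_mk_linForm {c : Fin 3 → k} (hc : c 2 ≠ 0)
    (M : Submodule k (MvPolynomial (Fin 3) k)) :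
    Module.finrank k (M.map (Ideal.Quotient.mkₐ k (Ideal.span {linForm c})).toLinearMap) =
      Module.finrank k
        (M.map (planeRestrict (-c 0 / c 2) (-c 1 / c 2)).toLinearMap) := by
  rw [← ker_planeRestrict hc]
  let e := Ideal.quotientKerAlgEquivOfSurjective
    (planeRestrict_surjective (-c 0 / c 2) (-c 1 / c 2))
  rw [← e.toLinearEquiv.finrank_map_eq, ← Submodule.map_comp]
  rfl

theorem map_planeRestrict_span (p : ℕ) [CharP k p] [Fact p.Prime] (G : MvPolynomial (Fin 3) k) :
    (Submodule.span k {X 0 ^ p * G, X 1 ^ p * G, X 2 ^ p * G}).map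
        (planeRestrict a b).toLinearMap =
      Submodule.span k (Set.range fun i : Fin 2 => X i ^ p * planeRestrict a b G) := by
  have hr : (Set.range fun i : Fin 2 => X i ^ p * planeRestrict a b G) =
      {X 0 ^ p * planeRestrict a b G, X 1 ^ p * planeRestrict a b G} := by
    ext f
    simp [Fin.exists_fin_two, eq_comm]
  have hz : planeRestrict a b (X 2) ^ p = C (a ^ p) * X 0 ^ p + C (b ^ p) * X 1 ^ p := by
    simp [planeRestrict, add_pow_char, mul_pow]
  have h0 : planeRestrict a b (X 0) = X 0 := by simp [planeRestrict]
  have h1 : planeRestrict a b (X 1) = X 1 := by simp [planeRestrict]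
  rw [Submodule.map_span, hr]
  simp only [Set.image_insert_eq, Set.image_singleton, AlgHom.toLinearMap_apply, map_mul, map_pow,
    h0, h1, hz]
  apply le_antisymm
  · rw [Submodule.span_le]
    rintro f (rfl | rfl | rfl)
    · exact Submodule.subset_span (by simp)
    · exact Submodule.subset_span (by simp)
    · refine Submodule.mem_span_pair.2 ⟨a ^ p, b ^ p, ?_⟩
      simp only [smul_eq_C_mul, map_pow]
      ring
  · exact Submodule.span_mono (by grind)

/-- Witnessing the restriction at the plane point `c × (u₂, 0, -u₀)`, for `u` off the zero locus
of `G`, gives a polynomial condition on `c`. -/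
theorem exists_planeRestrict_ne_zero [Infinite k] {G : MvPolynomial (Fin 3) k} (hG : G ≠ 0) :
    ∃ Q : MvPolynomial (Fin 3) k, Q ≠ 0 ∧ ∀ c : Fin 3 → k, eval c Q ≠ 0 →
      c 2 ≠ 0 ∧ planeRestrict (-c 0 / c 2) (-c 1 / c 2) G ≠ 0 := by
  obtain ⟨u, hu⟩ : ∃ u, eval u (G * X 2) ≠ 0 := by
    by_contra! h
    exact mul_ne_zero hG (X_ne_zero 2) (MvPolynomial.funext fun u => by simpa using h u)
  simp only [map_mul, eval_X, mul_ne_zero_iff] at hu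
  let T : MvPolynomial (Fin 3) k →ₐ[k] MvPolynomial (Fin 3) k :=
    aeval ![-(C (u 0) * X 1), C (u 2) * X 2 + C (u 0) * X 0, -(C (u 2) * X 1)]
  have hT : ∀ c : Fin 3 → k, eval c (T G) =
      eval ![-(u 0 * c 1), u 2 * c 2 + u 0 * c 0, -(u 2 * c 1)] G := by
    intro c
    have h : (aeval c).comp T = aeval ![-(u 0 * c 1), u 2 * c 2 + u 0 * c 0, -(u 2 * c 1)] := by
      refine algHom_ext fun i => ?_
      fin_cases i <;> simp [T]
    exact DFunLike.congr_fun h G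
  refine ⟨X 2 * T G, mul_ne_zero (X_ne_zero 2) fun h => ?_, fun c hc => ?_⟩
  · have h' := hT ![0, -1, u 1 / u 2]
    rw [h, map_zero] at h'
    apply hu.1
    rw [h']
    congr 2
    ext i
    fin_cases i <;> simp [mul_div_cancel₀, hu.2]
  · simp only [map_mul, eval_X, mul_ne_zero_iff] at hc
    refine ⟨hc.1, fun h => hc.2 ?_⟩
    have h' := eval_planeRestrict (-c 0 / c 2) (-c 1 / c 2)
      ![-(u 0 * c 1), u 2 * c 2 + u 0 * c 0] G
    rw [h, map_zero] at h'
    rw [hT, h']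
    congr 2
    ext i
    have := hc.1
    fin_cases i
    · rfl
    · rfl
    · simp
      field_simp
      ring

end planeRestrict

/-- Remark 5.3: failure of Green's Theorem 4 in positive characteristic. In
`R = k[x,y,z]` with `char k = p > 0`, `d ≥ p` and `G` a nonzero form of degree
`d - p`, the space `W = ⟨x^p G, y^p G, z^p G⟩ ⊆ R_d` satisfies
`codim W = C(d+2,2) - 3 = C(d+1,d) + C(d,d-1) + ⋯ + C(3,2)`, while for a
general linear form `ℓ` the image `W_H` of `W` in `(R/(ℓ))_d` has
`dim W_H = 2`, i.e. `codim W_H = d - 1`. -/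
theorem green_theorem_4_fails_char_p
    (k : Type*) [Field k] [Infinite k] (p : ℕ) [CharP k p] (hp : 0 < p)
    (d : ℕ) (hd : p ≤ d)
    (G : MvPolynomial (Fin 3) k) (hG : G.IsHomogeneous (d - p)) (hG0 : G ≠ 0)
    (W : Submodule k (MvPolynomial (Fin 3) k))
    (hW : W = Submodule.span k {X 0 ^ p * G, X 1 ^ p * G, X 2 ^ p * G}) :
    Module.finrank k (homogeneousSubmodule (Fin 3) k d) - Module.finrank k W =
      Nat.choose (d + 2) 2 - 3 ∧
    Nat.choose (d + 2) 2 - 3 =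
      ∑ j ∈ Finset.range (d - 1), Nat.choose (d + 1 - j) (d - j) ∧
    Generically k 3 (fun L =>
      Module.finrank k (Submodule.map
        (Ideal.Quotient.mkₐ k (Ideal.span {L})).toLinearMap W) = 2 ∧
      hilb k 3 (Ideal.span {L}) d - Module.finrank k (Submodule.map
        (Ideal.Quotient.mkₐ k (Ideal.span {L})).toLinearMap W) = d - 1) := by
  have hprime : p.Prime := (CharP.char_is_prime_or_zero k p).resolve_right hp.ne'
  have : Fact p.Prime := ⟨hprime⟩
  have hd1 : 1 ≤ d := hp.trans_le hd
  refine ⟨?_, choose_sub_three_eq_sum d hd1, ?_⟩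
  · have hr : (Set.range fun i : Fin 3 => X i ^ p * G) =
        {X 0 ^ p * G, X 1 ^ p * G, X 2 ^ p * G} := by
      ext f
      simp [Fin.exists_fin_succ, eq_comm]
    rw [finrank_homogeneousSubmodule_fin, hW, ← hr, finrank_span_X_pow_mul hp.ne' hG0,
      show 3 + d - 1 = d + 2 by lia, ← Nat.choose_symm_add]
  · obtain ⟨Q, hQ, h⟩ := exists_planeRestrict_ne_zero hG0
    refine ⟨Q, hQ, fun c hc => ?_⟩
    obtain ⟨hc2, hGc⟩ := h c hc
    have hdim : Module.finrank k (Submodule.map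
        (Ideal.Quotient.mkₐ k (Ideal.span {linForm c})).toLinearMap W) = 2 := by
      rw [finrank_map_mk_linForm hc2, hW, map_planeRestrict_span _ _ p,
        finrank_span_X_pow_mul hp.ne' hGc]
    refine ⟨hdim, ?_⟩
    rw [hdim, hilb, gradedPiece, finrank_map_mk_linForm hc2,
      map_planeRestrict_homogeneousSubmodule, finrank_homogeneousSubmodule_fin,
      show 2 + d - 1 = d + 1 by lia, Nat.choose_succ_self_right]
    lia
end
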